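/- Let n ≥ 1 and for each k ∈ Fin n let Φ_k be a mixed unitary qubit channel given by 2×2 unitaries U_{k,1},…,U_{k,m_k} and probabilities p_{k,1},…,p_{k,m_k} > 0 with Σⱼ p_{k,j} = 1. Let Φ = Φ₁ ⊗ ⋯ ⊗ Φ_n be the uncorrelated n-qubit channel acting on matrices indexed by (Fin n → Fin 2): Φ(ρ) = Σ over multi-indices j of (∏_k p_{k, j_k}) · W_j ρ W_j*, where W_j is the tensor product matrix with entries W_j(x,y) = ∏_k U_{k, j_k}(x_k, y_k). Let v₀ be the standard basis vector |0⋯00⟩ (indicator of the all-zeros string) and v₁ = |0⋯01⟩ (indicator of the string that is 0 everywhere except 1 in the last position). Then F(Φ(v₀v₀*), Φ(v₁v₁*)) = 0 if and only if U_{n,j}* U_{n,i} is a diagonal matrix for all 1 ≤ i, j ≤ m_n, where Φ_n is the channel acting on the last qubit. -/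

import Mathlib

open Matrix ComplexOrder

/-- The positive semidefinite square root of a matrix (junk value `0` if not PSD). -/
noncomputable def psdSqrt {n : Type*} [Fintype n] [DecidableEq n]
    (A : Matrix n n ℂ) : Matrix n n ℂ :=
  letI := Classical.propDecidable A.PosSemidef
  if h : A.PosSemidef then
    (h.1.eigenvectorUnitary : Matrix n n ℂ) *
      diagonal ((fun r : ℝ => (r : ℂ)) ∘ Real.sqrt ∘ h.1.eigenvalues) *
      (star h.1.eigenvectorUnitary : Matrix n n ℂ)
  else 0

/-- Fidelity `F(ρ,σ) = tr √(√σ ρ √σ)`. -/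
noncomputable def fid {n : Type*} [Fintype n] [DecidableEq n]
    (ρ σ : Matrix n n ℂ) : ℝ :=
  (psdSqrt (psdSqrt σ * ρ * psdSqrt σ)).trace.re

/-- Trace norm `‖M‖₁ = tr √(M* M)`. -/
noncomputable def traceNorm {n : Type*} [Fintype n] [DecidableEq n]
    (M : Matrix n n ℂ) : ℝ :=
  (psdSqrt (Mᴴ * M)).trace.re

/-- Inner product on `ℂ^ι`, conjugate-linear in the first argument. -/
noncomputable def cinner {ι : Type*} [Fintype ι] (x y : ι → ℂ) : ℂ := star x ⬝ᵥ y

/-- Rank-one density operator `φφ*` of a vector `φ`. -/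
noncomputable def outer {ι : Type*} [Fintype ι] (φ : ι → ℂ) : Matrix ι ι ℂ :=
  vecMulVec φ (star φ)

theorem psdSqrt_psd {n : Type*} [Fintype n] [DecidableEq n] (A : Matrix n n ℂ) :
    (psdSqrt A).PosSemidef := by
  unfold psdSqrt
  split_ifs with h
  · have hd : (diagonal ((fun r : ℝ => (r : ℂ)) ∘ Real.sqrt ∘ h.1.eigenvalues)).PosSemidef := by
      rw [posSemidef_diagonal_iff]
      intro i
      simp only [Function.comp]
      exact_mod_cast Real.sqrt_nonneg _
    exact hd.mul_mul_conjTranspose_same _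
  · exact PosSemidef.zero

theorem psdSqrt_sq {n : Type*} [Fintype n] [DecidableEq n] (A : Matrix n n ℂ)
    (h : A.PosSemidef) : psdSqrt A * psdSqrt A = A := by
  unfold psdSqrt
  rw [dif_pos h]
  have h1 : (star h.1.eigenvectorUnitary : Matrix n n ℂ) * (h.1.eigenvectorUnitary : Matrix n n ℂ) = 1 := by
    exact Unitary.coe_star_mul_self h.1.eigenvectorUnitary
  have h2 := h.1.spectral_theorem
  rw [Unitary.conjStarAlgAut_apply] at h2
  conv_rhs => rw [h2]
  simp only [mul_assoc]
  rw [← mul_assoc (star h.1.eigenvectorUnitary : Matrix n n ℂ) (h.1.eigenvectorUnitary : Matrix n n ℂ), h1, one_mul,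
    ← mul_assoc (diagonal _) (diagonal _), diagonal_mul_diagonal]
  congr 3
  ext i
  simp only [Function.comp]
  congr 1
  rw [← Complex.ofReal_mul, Real.mul_self_sqrt (h.eigenvalues_nonneg i)]
  rfl

theorem fid_zero_iff {n : Type*} [Fintype n] [DecidableEq n] (ρ σ : Matrix n n ℂ)
    (hρ : ρ.PosSemidef) (hσ : σ.PosSemidef) : fid ρ σ = 0 ↔ (ρ * σ).trace = 0 := by
  have hS := psdSqrt_psd σ
  have hB : (psdSqrt σ * ρ * psdSqrt σ).PosSemidef := by
    have := hρ.mul_mul_conjTranspose_same (psdSqrt σ)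
    rwa [hS.1.eq] at this
  have htr : (psdSqrt σ * ρ * psdSqrt σ).trace = (ρ * σ).trace := by
    rw [mul_assoc, trace_mul_comm, mul_assoc, psdSqrt_sq σ hσ]
  have hR := psdSqrt_psd (psdSqrt σ * ρ * psdSqrt σ)
  have hRR := psdSqrt_sq _ hB
  have hre : fid ρ σ = 0 ↔ (psdSqrt (psdSqrt σ * ρ * psdSqrt σ)).trace = 0 := by
    have h0 := (Complex.nonneg_iff.1 hR.trace_nonneg).2
    unfold fid
    constructor
    · intro h
      exact Complex.ext h h0.symm
    · intro h
      rw [h]; rfl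
  rw [hre, hR.trace_eq_zero_iff, ← htr, hB.trace_eq_zero_iff]
  constructor
  · intro h
    rw [h] at hRR
    rw [← hRR, mul_zero]
  · intro h
    rw [h] at hRR
    apply Matrix.conjTranspose_mul_self_eq_zero.1
    rw [hR.1.eq, h]
    exact hRR

theorem trace_outer_mul {ι : Type*} [Fintype ι] (a b : ι → ℂ) :
    (outer a * outer b).trace = ((Complex.normSq (star a ⬝ᵥ b) : ℝ) : ℂ) := by
  unfold outer
  rw [vecMulVec_mul_vecMulVec, vecMulVec_smul, trace_smul, trace_vecMulVec, Complex.normSq_eq_conj_mul_self, smul_eq_mul, mul_comm]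
  congr 1
  rw [starRingEnd_apply, ← star_dotProduct_star]
  simp [dotProduct_comm]

theorem mul_outer_mul {ι : Type*} [Fintype ι] (W : Matrix ι ι ℂ) (v : ι → ℂ) :
    W * outer v * Wᴴ = outer (W *ᵥ v) := by
  unfold outer
  rw [mul_vecMulVec, vecMulVec_mul, star_mulVec]

theorem outer_psd {ι : Type*} [Fintype ι] (v : ι → ℂ) : (outer v).PosSemidef :=
  posSemidef_vecMulVec_self_star v

theorem fid_mix {ι J : Type*} [Fintype ι] [DecidableEq ι] [Fintype J] (c : J → ℝ) (hc : ∀ j, 0 < c j)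
    (a b : J → ι → ℂ) :
    fid (∑ j, (c j : ℂ) • outer (a j)) (∑ j, (c j : ℂ) • outer (b j)) = 0 ↔
      ∀ i j, star (a i) ⬝ᵥ b j = 0 := by
  have hpsd : ∀ a : J → ι → ℂ, (∑ j, (c j : ℂ) • outer (a j)).PosSemidef := by
    intro a
    refine posSemidef_sum _ fun j _ => (outer_psd (a j)).smul ?_
    exact_mod_cast (hc j).le
  rw [fid_zero_iff _ _ (hpsd a) (hpsd b)]
  have : ((∑ j, (c j : ℂ) • outer (a j)) * (∑ j, (c j : ℂ) • outer (b j))).trace =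
      ((∑ i, ∑ j, c i * (c j * Complex.normSq (star (a i) ⬝ᵥ b j)) : ℝ) : ℂ) := by
    rw [Finset.sum_mul_sum, trace_sum]
    push_cast
    refine Finset.sum_congr rfl fun i _ => ?_
    rw [trace_sum]
    refine Finset.sum_congr rfl fun j _ => ?_
    rw [smul_mul_smul_comm, trace_smul, trace_outer_mul, smul_eq_mul, mul_assoc]
  have hnn : ∀ i j, 0 ≤ c i * (c j * Complex.normSq (star (a i) ⬝ᵥ b j)) := fun i j =>
    mul_nonneg (hc i).le (mul_nonneg (hc j).le (Complex.normSq_nonneg _))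
  rw [this, Complex.ofReal_eq_zero,
    Finset.sum_eq_zero_iff_of_nonneg (fun i _ => Finset.sum_nonneg fun j _ => hnn i j)]
  refine forall_congr' fun i => ?_
  rw [Finset.sum_eq_zero_iff_of_nonneg (fun j _ => hnn i j)]
  simp [(hc _).ne']

theorem inner_cols {n : ℕ} (A B : Fin n → Matrix (Fin 2) (Fin 2) ℂ) (y z : Fin n → Fin 2) :
    star ((Matrix.of fun x y : Fin n → Fin 2 => ∏ k, A k (x k) (y k)) *ᵥ
      (fun x => if x = y then (1 : ℂ) else 0)) ⬝ᵥ
      ((Matrix.of fun x y : Fin n → Fin 2 => ∏ k, B k (x k) (y k)) *ᵥ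
      (fun x => if x = z then (1 : ℂ) else 0)) = ∏ k, ((A k)ᴴ * B k) (y k) (z k) := by
  simp only [mulVec, dotProduct, Pi.star_apply, of_apply, mul_ite, mul_one, mul_zero,
    Finset.sum_ite_eq', Finset.mem_univ, if_true, star_prod, ← Finset.prod_mul_distrib,
    Matrix.mul_apply, conjTranspose_apply]
  rw [Finset.prod_univ_sum, Fintype.piFinset_univ]

theorem stmt7 (n : ℕ) (hn : 1 ≤ n) (m : Fin n → ℕ) (hm : ∀ k, 1 ≤ m k)
    (p : ∀ k, Fin (m k) → ℝ) (hp : ∀ k i, 0 < p k i) (hpsum : ∀ k, ∑ i, p k i = 1)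
    (U : ∀ k, Fin (m k) → Matrix (Fin 2) (Fin 2) ℂ)
    (hU : ∀ k i, (U k i)ᴴ * U k i = 1) :
    fid
      (∑ j : (∀ k, Fin (m k)), ((∏ k, p k (j k) : ℝ) : ℂ) •
        ((Matrix.of fun x y : Fin n → Fin 2 => ∏ k, U k (j k) (x k) (y k)) *
          outer (fun x : Fin n → Fin 2 => if x = (fun _ => 0) then (1 : ℂ) else 0) *
          (Matrix.of fun x y : Fin n → Fin 2 => ∏ k, U k (j k) (x k) (y k))ᴴ))
      (∑ j : (∀ k, Fin (m k)), ((∏ k, p k (j k) : ℝ) : ℂ) •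
        ((Matrix.of fun x y : Fin n → Fin 2 => ∏ k, U k (j k) (x k) (y k)) *
          outer (fun x : Fin n → Fin 2 =>
            if x = (fun k : Fin n => if (k : ℕ) = n - 1 then (1 : Fin 2) else 0) then (1 : ℂ) else 0) *
          (Matrix.of fun x y : Fin n → Fin 2 => ∏ k, U k (j k) (x k) (y k))ᴴ)) = 0 ↔
      ∀ i j : Fin (m ⟨n - 1, by omega⟩),
        ((U ⟨n - 1, by omega⟩ j)ᴴ * U ⟨n - 1, by omega⟩ i).IsDiag := by
  simp only [mul_outer_mul]
  rw [fid_mix (fun j : (∀ k, Fin (m k)) => ∏ k, p k (j k)) (fun j => Finset.prod_pos fun k _ => hp k _)]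
  simp only [inner_cols]
  constructor
  · intro h
    have key : ∀ i j : Fin (m ⟨n - 1, by omega⟩),
        ((U ⟨n - 1, by omega⟩ j)ᴴ * U ⟨n - 1, by omega⟩ i) 0 1 = 0 := by
      intro i j
      let f : ∀ k, Fin (m k) := fun k => ⟨0, hm k⟩
      have := h (Function.update f ⟨n - 1, by omega⟩ j) (Function.update f ⟨n - 1, by omega⟩ i)
      rw [Finset.prod_eq_zero_iff] at this
      obtain ⟨k, -, hk⟩ := this
      by_cases hkn : k = ⟨n - 1, by omega⟩
      · subst hkn
        simpa using hk
      · have hk' : (k : ℕ) ≠ n - 1 := fun e => hkn (Fin.ext e)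
        rw [Function.update_of_ne hkn, Function.update_of_ne hkn, hU, if_neg hk'] at hk
        simp at hk
    intro i j a b hab
    fin_cases a <;> fin_cases b
    · exact absurd rfl hab
    · exact key i j
    · have := congrArg star (key j i)
      rw [← conjTranspose_apply, conjTranspose_mul, conjTranspose_conjTranspose, star_zero] at this
      exact this
    · exact absurd rfl hab
  · intro h i j
    apply Finset.prod_eq_zero (Finset.mem_univ (⟨n - 1, by omega⟩ : Fin n))
    simp only [if_true]
    exact h _ _ (by decide)
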